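/- There exists a choice of the constants C₁ < ⋯ < C_{d−1} and D₁ < ⋯ < D_{d−1} (with C₀ = D₀ = 1), depending only on d, ε, δ, τ, 𝔠 and 𝔉, such that the extended blocks are invariant under resonant normal forms in the following combinatorial sense: for every submodule M ⊆ ℤ^d of dimension s (0 ≤ s ≤ d), every ζ ∈ E⁽ˢ⁾_M (where E⁽ˢ⁾_M means E⁽⁰⁾ when M = {0} and E⁽ᵈ⁾ when M = ℤ^d), and every nonzero k ∈ ℤ^d with ζ+k ∈ E satisfying |⟨ζ+κ+k/2, k⟩| ≤ ⟨ζ+κ+k/2⟩^δ ‖k‖^{−τ} and ‖k‖ ≤ ⟨ζ+κ+k/2⟩^ε, one has k ∈ M and ζ+k ∈ E⁽ˢ⁾_M. -/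

import Mathlib

/-- A positive definite symmetric bilinear form on `ℝ^d`. -/
structure PDForm (d : ℕ) where
  B : (Fin d → ℝ) →ₗ[ℝ] (Fin d → ℝ) →ₗ[ℝ] ℝ
  symm : ∀ x y, B x y = B y x
  posdef : ∀ x, x ≠ 0 → 0 < B x x

namespace PDForm

variable {d : ℕ} (g : PDForm d)

/-- The inner product `⟨·,·⟩` associated with the form. -/
def inn (x y : Fin d → ℝ) : ℝ := g.B x y

/-- The norm `‖·‖` associated with the form. -/
noncomputable def nrm (x : Fin d → ℝ) : ℝ := Real.sqrt (g.inn x x)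

/-- The Japanese bracket `⟨x⟩ = (1+‖x‖²)^{1/2}`. -/
noncomputable def jap (x : Fin d → ℝ) : ℝ := Real.sqrt (1 + g.inn x x)

end PDForm

/-- Cast of a lattice vector of `ℤ^d` into `ℝ^d`. -/
def zc {d : ℕ} (k : Fin d → ℤ) : Fin d → ℝ := fun i => (k i : ℝ)

/-- `𝔠 := min{‖k‖² : k ∈ ℤ^d, k ≠ 0}`. -/
noncomputable def frakc {d : ℕ} (g : PDForm d) : ℝ :=
  sInf {x | ∃ k : Fin d → ℤ, k ≠ 0 ∧ x = (g.nrm (zc k)) ^ 2}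

/-- Gram volume `√det(⟨u_i,u_j⟩)` of an `s`-tuple of vectors. -/
noncomputable def gvol {d s : ℕ} (g : PDForm d) (u : Fin s → (Fin d → ℝ)) : ℝ :=
  Real.sqrt (Matrix.det (Matrix.of fun i j => g.inn (u i) (u j)))

/-- `𝔉`, the minimal Gram volume of parallelepipeds with linearly independent integer edges. -/
noncomputable def frakC {d : ℕ} (g : PDForm d) : ℝ :=
  sInf {x | ∃ (s : ℕ) (u : Fin s → (Fin d → ℤ)), 1 ≤ s ∧ s ≤ d ∧
    LinearIndependent ℝ (fun j => zc (u j)) ∧ x = gvol g (fun j => zc (u j))}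

/-- A submodule of `ℤ^d` in the sense of the paper: `span_ℝ(M) ∩ ℤ^d = M`. -/
def IsSat {d : ℕ} (M : Submodule ℤ (Fin d → ℤ)) : Prop :=
  ∀ k : Fin d → ℤ, zc k ∈ Submodule.span ℝ (zc '' (M : Set (Fin d → ℤ))) → k ∈ M

/-- The dimension (rank) of a submodule of `ℤ^d`. -/
noncomputable def zrank {d : ℕ} (M : Submodule ℤ (Fin d → ℤ)) : ℕ := Module.finrank ℤ M

/-- `ξ_k := ξ + κ + k/2`. -/
noncomputable def xik {d : ℕ} (κ : Fin d → ℝ) (ξ k : Fin d → ℤ) : Fin d → ℝ :=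
  fun i => (ξ i : ℝ) + κ i + (k i : ℝ) / 2

/-- All the data entering the definition of the resonant zones. -/
structure ZoneData (d : ℕ) where
  g : PDForm d
  κ : Fin d → ℝ
  E : Set (Fin d → ℤ)
  δ : ℝ
  ε : ℝ
  τ : ℝ
  Cs : ℕ → ℝ
  Ds : ℕ → ℝ

namespace ZoneData

variable {d : ℕ} (Z : ZoneData d)

/-- `δ_s := δ + s (d+τ+1) ε`. -/
noncomputable def δs (s : ℕ) : ℝ := Z.δ + s * ((d + Z.τ + 1) * Z.ε)

/-- The completely nonresonant zone `Z⁽⁰⁾`. -/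
noncomputable def Z0 : Set (Fin d → ℤ) :=
  {ξ | ξ ∈ Z.E ∧ ∀ k : Fin d → ℤ, k ≠ 0 →
    Z.g.nrm (zc k) ≤ (Z.g.jap (xik Z.κ ξ k)) ^ Z.ε →
    |Z.g.inn (xik Z.κ ξ k) (zc k)| >
      (Z.g.jap (xik Z.κ ξ k)) ^ Z.δ * (Z.g.nrm (zc k)) ^ (-Z.τ)}

/-- The resonant zone `Z⁽ˢ⁾_M`, union over linearly independent `s`-tuples in `M`
of the zones `Z_{k₁,…,k_s}`. -/
noncomputable def ZM (s : ℕ) (M : Submodule ℤ (Fin d → ℤ)) : Set (Fin d → ℤ) :=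
  {ξ | ξ ∈ Z.E ∧ ∃ (hs : 0 < s) (k : Fin s → (Fin d → ℤ)),
    (∀ j, k j ∈ M) ∧ LinearIndependent ℝ (fun j => zc (k j)) ∧
    ∀ j : Fin s,
      |Z.g.inn (xik Z.κ ξ (k ⟨0, hs⟩)) (zc (k j))| ≤
        Z.Cs j * (Z.g.jap (xik Z.κ ξ (k ⟨0, hs⟩))) ^ (Z.δs j) * (Z.g.nrm (zc (k j))) ^ (-Z.τ) ∧
      Z.g.nrm (zc (k j)) ≤ Z.Ds j * (Z.g.jap (xik Z.κ ξ (k ⟨0, hs⟩))) ^ Z.ε}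

/-- The resonant block `B⁽ˢ⁾_M`. -/
noncomputable def BM (s : ℕ) (M : Submodule ℤ (Fin d → ℤ)) : Set (Fin d → ℤ) :=
  Z.ZM s M \
    ⋃ (M' : Submodule ℤ (Fin d → ℤ)) (_ : IsSat M' ∧ zrank M' = s + 1), Z.ZM (s + 1) M'

/-- The extended block `E⁽ˢ⁾_M` (for `s ≥ 1`). -/
noncomputable def EM : ℕ → Submodule ℤ (Fin d → ℤ) → Set (Fin d → ℤ)
  | s, M =>
    {ξ | (∃ b ∈ Z.BM s M, ∃ m ∈ M, ξ = b + m) ∧ ξ ∈ Z.ZM s M ∧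
      ∀ r, 1 ≤ r → r < s → ∀ M' : Submodule ℤ (Fin d → ℤ),
        IsSat M' → zrank M' = r → ξ ∉ EM r M'}
  termination_by s => s

end ZoneData

/-- Conditions on the parameters `δ, ε, τ`. -/
def ParamsOK (d : ℕ) (δ ε τ : ℝ) : Prop :=
  1 ≤ d ∧ 0 < δ ∧ δ < 1 ∧ 0 < ε ∧ (d : ℝ) - 1 < τ ∧
    δ + d * ((d + τ + 1) * ε) < 1 ∧ ε * (τ + 1) ≤ δ

/-- Conditions `1 = C₀ < C₁ < ⋯ < C_{d-1}` and `1 = D₀ < D₁ < ⋯ < D_{d-1}`. -/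
def SeqOK (d : ℕ) (Cs Ds : ℕ → ℝ) : Prop :=
  Cs 0 = 1 ∧ Ds 0 = 1 ∧ (∀ j, j + 2 ≤ d → Cs j < Cs (j + 1)) ∧
    (∀ j, j + 2 ≤ d → Ds j < Ds (j + 1))

namespace PDForm

variable {d : ℕ} (g : PDForm d)

lemma inn_add_left (x y z : Fin d → ℝ) : g.inn (x + y) z = g.inn x z + g.inn y z := by
  simp [inn]

lemma inn_sub_left (x y z : Fin d → ℝ) : g.inn (x - y) z = g.inn x z - g.inn y z := by
  simp [inn]

lemma inn_comm (x y : Fin d → ℝ) : g.inn x y = g.inn y x := g.symm x y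

lemma inn_self_nonneg (x : Fin d → ℝ) : 0 ≤ g.inn x x := by
  by_cases hx : x = 0
  · simp [inn, hx]
  · exact (g.posdef x hx).le

lemma nrm_nonneg (x : Fin d → ℝ) : 0 ≤ g.nrm x := Real.sqrt_nonneg _

lemma nrm_sq (x : Fin d → ℝ) : g.nrm x ^ 2 = g.inn x x := Real.sq_sqrt (g.inn_self_nonneg x)

lemma nrm_neg (x : Fin d → ℝ) : g.nrm (-x) = g.nrm x := by simp [nrm, inn]

lemma nrm_half_smul (x : Fin d → ℝ) : g.nrm ((1 / 2 : ℝ) • x) = g.nrm x / 2 := by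
  have h : g.inn ((1 / 2 : ℝ) • x) ((1 / 2 : ℝ) • x) = (1 / 2) ^ 2 * g.inn x x := by
    simp [inn]; ring
  rw [nrm, h, Real.sqrt_mul (by positivity), Real.sqrt_sq (by norm_num), nrm]
  ring

/-- The Cauchy–Schwarz inequality. -/
lemma abs_inn_le (x y : Fin d → ℝ) : |g.inn x y| ≤ g.nrm x * g.nrm y := by
  have h := LinearMap.BilinForm.apply_mul_apply_le_of_forall_zero_le g.B
    (fun x => g.inn_self_nonneg x) x y
  rw [← g.symm x y] at h
  rw [nrm, nrm, ← Real.sqrt_mul (g.inn_self_nonneg x)]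
  refine Real.abs_le_sqrt ?_
  rw [sq]
  exact h

lemma nrm_add_le (x y : Fin d → ℝ) : g.nrm (x + y) ≤ g.nrm x + g.nrm y := by
  have hx := g.nrm_nonneg x
  have hy := g.nrm_nonneg y
  refine Real.sqrt_le_iff.2 ⟨by positivity, ?_⟩
  have h := (le_abs_self _).trans (g.abs_inn_le x y)
  have hexp : g.inn (x + y) (x + y) = g.nrm x ^ 2 + 2 * g.inn x y + g.nrm y ^ 2 := by
    rw [nrm_sq, nrm_sq, inn_add_left, g.inn_comm x (x + y), g.inn_comm y (x + y),
      inn_add_left, inn_add_left, g.inn_comm y x]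
    ring
  rw [hexp]
  nlinarith

lemma one_le_jap (x : Fin d → ℝ) : 1 ≤ g.jap x :=
  Real.one_le_sqrt.2 (by linarith [g.inn_self_nonneg x])

lemma jap_add_le (x y : Fin d → ℝ) : g.jap (x + y) ≤ g.jap x + g.nrm y := by
  have hx := g.one_le_jap x
  have hy := g.nrm_nonneg y
  refine Real.sqrt_le_iff.2 ⟨by positivity, ?_⟩
  have hle : g.nrm x ≤ g.jap x := Real.sqrt_le_sqrt (by linarith)
  have hsq : g.jap x ^ 2 = 1 + g.inn x x := Real.sq_sqrt (by linarith [g.inn_self_nonneg x])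
  have h := (le_abs_self _).trans (g.abs_inn_le x y)
  have hexp : g.inn (x + y) (x + y) = g.inn x x + 2 * g.inn x y + g.nrm y ^ 2 := by
    rw [nrm_sq, inn_add_left, g.inn_comm x (x + y), g.inn_comm y (x + y),
      inn_add_left, inn_add_left, g.inn_comm y x]
    ring
  rw [hexp]
  nlinarith [mul_le_mul_of_nonneg_right hle hy]

/-- The Japanese bracket is 1-Lipschitz. -/
lemma abs_jap_sub_le (x y : Fin d → ℝ) : |g.jap x - g.jap y| ≤ g.nrm (x - y) := by
  have h₁ := g.jap_add_le y (x - y)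
  have h₂ := g.jap_add_le x (y - x)
  rw [add_sub_cancel] at h₁ h₂
  rw [← neg_sub x y, nrm_neg] at h₂
  exact abs_le.2 ⟨by linarith, by linarith⟩

/-- Coercivity: a positive definite form dominates a multiple of the Euclidean one. -/
lemma exists_coercive : ∃ c > 0, ∀ x : Fin d → ℝ, c * (x ⬝ᵥ x) ≤ g.inn x x := by
  rcases Nat.eq_zero_or_pos d with rfl | hd
  · exact ⟨1, one_pos, fun x => by
      have := g.inn_self_nonneg x
      simpa using this⟩
  have hcont : Continuous fun x : Fin d → ℝ => g.inn x x := by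
    have h : (fun x : Fin d → ℝ => g.inn x x) =
        fun x => x ⬝ᵥ (LinearMap.toMatrix₂' ℝ g.B).mulVec x := by
      funext x
      rw [← Matrix.toLinearMap₂'_apply', Matrix.toLinearMap₂'_toMatrix', inn]
    rw [h]
    fun_prop
  have hne : (Metric.sphere (0 : Fin d → ℝ) 1).Nonempty := by
    have : Nonempty (Fin d) := ⟨⟨0, hd⟩⟩
    exact NormedSpace.sphere_nonempty.2 zero_le_one
  obtain ⟨x₀, hx₀, hmin⟩ :=
    (isCompact_sphere (0 : Fin d → ℝ) 1).exists_isMinOn hne hcont.continuousOn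
  have hpos : 0 < g.inn x₀ x₀ := g.posdef x₀ (by rintro rfl; simp at hx₀)
  have hd' : (0 : ℝ) < d := by exact_mod_cast hd
  refine ⟨g.inn x₀ x₀ / d, by positivity, fun x => ?_⟩
  by_cases hx : x = 0
  · simp [hx, inn]
  have hnx : 0 < ‖x‖ := norm_pos_iff.2 hx
  have h₁ : g.inn x₀ x₀ ≤ g.inn (‖x‖⁻¹ • x) (‖x‖⁻¹ • x) :=
    hmin (show _ ∈ Metric.sphere (0 : Fin d → ℝ) 1 by simp [norm_smul, hnx.ne'])
  have h₂ : g.inn (‖x‖⁻¹ • x) (‖x‖⁻¹ • x) = g.inn x x / ‖x‖ ^ 2 := by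
    simp [inn]; field_simp
  rw [h₂, le_div_iff₀ (by positivity)] at h₁
  have h₃ : x ⬝ᵥ x ≤ d * ‖x‖ ^ 2 := by
    calc x ⬝ᵥ x ≤ ∑ _i : Fin d, ‖x‖ ^ 2 := Finset.sum_le_sum fun i _ => by
          have := norm_le_pi_norm x i
          rw [← sq, ← sq_abs]
          exact pow_le_pow_left₀ (abs_nonneg _) this 2
      _ = d * ‖x‖ ^ 2 := by simp
  calc g.inn x₀ x₀ / d * (x ⬝ᵥ x) ≤ g.inn x₀ x₀ / d * (d * ‖x‖ ^ 2) := by gcongr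
    _ = g.inn x₀ x₀ * ‖x‖ ^ 2 := by field_simp
    _ ≤ g.inn x x := h₁

end PDForm

section Determinants

open scoped Matrix MatrixOrder in
/-- Monotonicity of the determinant on positive definite matrices. -/
lemma Matrix.PosDef.pow_mul_det_le_det {n : ℕ} {A B : Matrix (Fin n) (Fin n) ℝ} {c : ℝ}
    (hc : 0 ≤ c) (hB : B.PosDef) (hAB : (A - c • B).PosSemidef) :
    c ^ n * B.det ≤ A.det := by
  obtain ⟨S, hS⟩ := CStarAlgebra.nonneg_iff_eq_star_mul_self.mp hB.posSemidef.nonneg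
  rw [Matrix.star_eq_conjTranspose] at hS
  have hdetS : S.det ≠ 0 := fun h => hB.det_pos.ne' (by rw [hS]; simp [h])
  have hunit : IsUnit S.det := hdetS.isUnit
  set T := S⁻¹
  have hST : S * T = 1 := Matrix.mul_nonsing_inv S hunit
  have hTS : Tᴴ * Sᴴ = 1 := by rw [← Matrix.conjTranspose_mul, hST, Matrix.conjTranspose_one]
  have hconj : Tᴴ * (A - c • B) * T = Tᴴ * A * T - c • (1 : Matrix (Fin n) (Fin n) ℝ) := by
    rw [hS]
    simp only [mul_sub, sub_mul, Matrix.mul_smul, Matrix.smul_mul]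
    rw [show Tᴴ * (Sᴴ * S) * T = (Tᴴ * Sᴴ) * (S * T) by simp only [Matrix.mul_assoc], hTS, hST,
      one_mul]
  have hpsd : (Tᴴ * A * T - c • (1 : Matrix (Fin n) (Fin n) ℝ)).PosSemidef := by
    rw [← hconj]; exact hAB.conjTranspose_mul_mul_same T
  have hher : (Tᴴ * A * T).IsHermitian := by
    have h : Tᴴ * A * T =
        (Tᴴ * A * T - c • (1 : Matrix (Fin n) (Fin n) ℝ)) + c • 1 := by abel
    rw [h]
    exact hpsd.isHermitian.add (by simp [Matrix.IsHermitian])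
  have heig : ∀ i, c ≤ hher.eigenvalues i := by
    intro i
    have h := hpsd.dotProduct_mulVec_nonneg (hher.eigenvectorBasis i).ofLp
    have hnorm : (hher.eigenvectorBasis i).ofLp ⬝ᵥ (hher.eigenvectorBasis i).ofLp = 1 := by
      have h1 := hher.eigenvectorBasis.orthonormal.1 i
      have h2 := EuclideanSpace.inner_eq_star_dotProduct (𝕜 := ℝ) (hher.eigenvectorBasis i)
        (hher.eigenvectorBasis i)
      rw [real_inner_self_eq_norm_sq, h1] at h2
      simpa using h2.symm
    rw [Matrix.sub_mulVec, hher.mulVec_eigenvectorBasis, Matrix.smul_mulVec, Matrix.one_mulVec,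
      star_trivial, dotProduct_sub, dotProduct_smul, dotProduct_smul, hnorm] at h
    simpa using h
  have hle : c ^ n ≤ (Tᴴ * A * T).det := by
    rw [hher.det_eq_prod_eigenvalues]
    calc c ^ n = ∏ _i : Fin n, c := by simp
      _ ≤ _ := Finset.prod_le_prod (fun _ _ => hc) fun i _ => by simpa using heig i
  have hdet : (Tᴴ * A * T).det * B.det = A.det := by
    have h : S.det * T.det = 1 := by rw [← Matrix.det_mul, hST, Matrix.det_one]
    rw [hS]
    simp only [Matrix.det_mul, Matrix.det_conjTranspose, star_trivial]
    linear_combination A.det * (S.det * T.det + 1) * h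
  rw [← hdet]
  exact mul_le_mul_of_nonneg_right hle hB.det_pos.le

end Determinants

section Gram

open scoped Matrix

variable {d s : ℕ} (g : PDForm d)

/-- The Gram matrix of a family of vectors. -/
def PDForm.gram (u : Fin s → (Fin d → ℝ)) : Matrix (Fin s) (Fin s) ℝ :=
  Matrix.of fun i j => g.inn (u i) (u j)

lemma PDForm.gram_combination (u : Fin s → (Fin d → ℝ)) (T : Matrix (Fin s) (Fin s) ℝ) :
    g.gram (fun i => ∑ k, T i k • u k) = T * g.gram u * Tᵀ := by
  ext i j
  simp only [gram, Matrix.of_apply, PDForm.inn, map_sum, map_smul, LinearMap.sum_apply,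
    LinearMap.smul_apply, smul_eq_mul, Matrix.mul_apply, Matrix.transpose_apply]
  refine Finset.sum_congr rfl fun x _ => ?_
  rw [Finset.sum_mul, Finset.mul_sum]
  exact Finset.sum_congr rfl fun y _ => by ring

lemma PDForm.dotProduct_gram_mulVec (u : Fin s → (Fin d → ℝ)) (x : Fin s → ℝ) :
    x ⬝ᵥ (g.gram u *ᵥ x) = g.inn (∑ i, x i • u i) (∑ i, x i • u i) := by
  simp only [gram, dotProduct, Matrix.mulVec, Matrix.of_apply, PDForm.inn, map_sum, map_smul,
    LinearMap.sum_apply, LinearMap.smul_apply, smul_eq_mul, Finset.mul_sum]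
  rw [Finset.sum_comm]
  exact Finset.sum_congr rfl fun x _ => Finset.sum_congr rfl fun y _ => by ring

/-- A crude form of Hadamard's inequality. -/
lemma PDForm.det_gram_le (u : Fin s → (Fin d → ℝ)) :
    (g.gram u).det ≤ s.factorial * (∏ i, g.nrm (u i)) ^ 2 := by
  rw [Matrix.det_apply]
  calc ∑ σ : Equiv.Perm (Fin s), Equiv.Perm.sign σ • ∏ i, g.gram u (σ i) i
      ≤ ∑ _σ : Equiv.Perm (Fin s), (∏ i, g.nrm (u i)) ^ 2 := by
        refine Finset.sum_le_sum fun σ _ => ?_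
        refine (le_abs_self _).trans ?_
        have habs : |Equiv.Perm.sign σ • ∏ i, g.gram u (σ i) i| = ∏ i, |g.gram u (σ i) i| := by
          rw [← Finset.abs_prod]
          rcases Int.units_eq_one_or (Equiv.Perm.sign σ) with h | h <;> simp [h]
        rw [habs]
        calc ∏ i, |g.gram u (σ i) i| ≤ ∏ i, (g.nrm (u (σ i)) * g.nrm (u i)) :=
              Finset.prod_le_prod (fun _ _ => abs_nonneg _) fun i _ => g.abs_inn_le _ _
          _ = (∏ i, g.nrm (u i)) ^ 2 := by
              rw [Finset.prod_mul_distrib, Equiv.prod_comp σ fun i => g.nrm (u i), sq]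
    _ = s.factorial * (∏ i, g.nrm (u i)) ^ 2 := by
        simp [Fintype.card_perm]

/-- Replacing one vector of a family by a linear combination scales the Gram determinant by the
square of the corresponding coefficient. -/
lemma PDForm.det_gram_update (u : Fin s → (Fin d → ℝ)) (a : Fin s → ℝ) (j : Fin s) :
    (g.gram (Function.update u j (∑ k, a k • u k))).det = a j ^ 2 * (g.gram u).det := by
  set T : Matrix (Fin s) (Fin s) ℝ := ((1 : Matrix (Fin s) (Fin s) ℝ).updateCol j a)ᵀ with hT
  have hu : Function.update u j (∑ k, a k • u k) = fun i => ∑ k, T i k • u k := by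
    funext i
    by_cases hi : i = j
    · subst hi
      simp [hT]
    · simp [hT, hi, Matrix.one_apply]
  have hdet : T.det = a j := by
    rw [hT, Matrix.det_transpose, ← Matrix.cramer_apply, Matrix.cramer_one]
    simp
  rw [hu, gram_combination, Matrix.det_mul, Matrix.det_mul, Matrix.det_transpose T, hdet]
  ring

lemma PDForm.gvol_sq_le_det_gram {u : Fin s → (Fin d → ℝ)} {F : ℝ} (hF : 0 < F)
    (h : F ≤ gvol g u) : F ^ 2 ≤ (g.gram u).det :=
  (Real.le_sqrt' hF).1 h

/-- A vector that pairs weakly with each member of a family of nondegenerate volume pairs weakly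
with every vector of its span. -/
lemma PDForm.abs_inn_le_of_mem_span {u : Fin s → (Fin d → ℝ)} {F N X : ℝ} (hF : 0 < F)
    (hvol : F ≤ gvol g u) (hN : ∀ i, g.nrm (u i) ≤ N) {y : Fin d → ℝ}
    (hX : ∀ i, |g.inn y (u i)| ≤ X) {w : Fin d → ℝ}
    (hw : w ∈ Submodule.span ℝ (Set.range u)) :
    |g.inn y w| ≤ s * (s.factorial * N ^ (s - 1) / F) * X * g.nrm w := by
  obtain ⟨a, rfl⟩ := (Submodule.mem_span_range_iff_exists_fun ℝ).1 hw
  set w := ∑ i, a i • u i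
  have hw0 := g.nrm_nonneg w
  have hcoef : ∀ j, |a j| ≤ s.factorial * N ^ (s - 1) / F * g.nrm w := by
    intro j
    have hN0 : 0 ≤ N := (g.nrm_nonneg _).trans (hN j)
    have hprod : ∏ i, g.nrm (Function.update u j w i) ≤ N ^ (s - 1) * g.nrm w := by
      rw [← Finset.mul_prod_erase _ _ (Finset.mem_univ j), Function.update_self, mul_comm]
      refine mul_le_mul_of_nonneg_right ?_ hw0
      calc ∏ i ∈ Finset.univ.erase j, g.nrm (Function.update u j w i)
          ≤ ∏ _i ∈ Finset.univ.erase j, N := by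
            refine Finset.prod_le_prod (fun _ _ => g.nrm_nonneg _) fun i hi => ?_
            rw [Function.update_of_ne (Finset.ne_of_mem_erase hi)]
            exact hN i
        _ = N ^ (s - 1) := by simp [Finset.card_erase_of_mem]
    have hfac : (1 : ℝ) ≤ s.factorial := by exact_mod_cast s.factorial_pos
    have hsq : (F * |a j|) ^ 2 ≤ (s.factorial * N ^ (s - 1) * g.nrm w) ^ 2 := by
      calc (F * |a j|) ^ 2 = a j ^ 2 * F ^ 2 := by rw [mul_pow, sq_abs]; ring
        _ ≤ a j ^ 2 * (g.gram u).det := by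
            gcongr
            exact g.gvol_sq_le_det_gram hF hvol
        _ = (g.gram (Function.update u j w)).det := (g.det_gram_update u a j).symm
        _ ≤ s.factorial * (∏ i, g.nrm (Function.update u j w i)) ^ 2 := g.det_gram_le _
        _ ≤ (s.factorial : ℝ) ^ 2 * (N ^ (s - 1) * g.nrm w) ^ 2 := by
            gcongr
            · nlinarith
            · exact Finset.prod_nonneg fun _ _ => g.nrm_nonneg _
        _ = (s.factorial * N ^ (s - 1) * g.nrm w) ^ 2 := by ring
    have := abs_le_of_sq_le_sq hsq (by positivity)
    rw [div_mul_eq_mul_div, le_div_iff₀ hF]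
    linarith [le_abs_self (F * |a j|)]
  calc |g.inn y w| = |∑ i, a i * g.inn y (u i)| := by
        congr 1
        simp [w, PDForm.inn]
    _ ≤ ∑ i, |a i * g.inn y (u i)| := Finset.abs_sum_le_sum_abs _ _
    _ ≤ ∑ _i : Fin s, (s.factorial * N ^ (s - 1) / F * g.nrm w) * X := by
        refine Finset.sum_le_sum fun i _ => ?_
        rw [abs_mul]
        exact mul_le_mul (hcoef i) (hX i) (abs_nonneg _) ((abs_nonneg _).trans (hcoef i))
    _ = s * (s.factorial * N ^ (s - 1) / F) * X * g.nrm w := by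
        simp; ring

end Gram

section Volume

open scoped Matrix

variable {d : ℕ} (g : PDForm d)

lemma frakC_le_gvol {s : ℕ} (u : Fin s → (Fin d → ℤ)) (hs : 1 ≤ s)
    (hu : LinearIndependent ℝ fun j => zc (u j)) : frakC g ≤ gvol g fun j => zc (u j) := by
  refine csInf_le ⟨0, ?_⟩ ⟨s, u, hs, by simpa using hu.fintype_card_le_finrank, hu, rfl⟩
  rintro x ⟨s, u, -, -, -, rfl⟩
  exact Real.sqrt_nonneg _

lemma zc_ne_zero {k : Fin d → ℤ} (hk : k ≠ 0) : zc k ≠ 0 := by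
  contrapose! hk
  funext i
  have := congrFun hk i
  simpa [zc] using this

/-- Nonzero lattice vectors have norm at least `𝔉`. -/
lemma frakC_le_nrm {k : Fin d → ℤ} (hk : k ≠ 0) : frakC g ≤ g.nrm (zc k) := by
  have h := frakC_le_gvol g (fun _ : Fin 1 => k) le_rfl
    (LinearIndependent.of_subsingleton 0 (zc_ne_zero hk))
  simpa [gvol, PDForm.nrm] using h

/-- The Euclidean Gram determinant of linearly independent lattice vectors is at least one. -/
lemma one_le_det_dotProduct {s : ℕ} (u : Fin s → (Fin d → ℤ))
    (hu : LinearIndependent ℝ fun j => zc (u j)) :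
    let B : Matrix (Fin s) (Fin s) ℝ := Matrix.of fun i j => zc (u i) ⬝ᵥ zc (u j)
    B.PosDef ∧ 1 ≤ B.det := by
  intro B
  have hB : B.PosDef := by
    have h : B = (Matrix.of fun i => zc (u i)) * (Matrix.of fun i => zc (u i))ᴴ := by
      ext i j
      simp [B, Matrix.mul_apply, dotProduct]
    rw [h]
    refine Matrix.PosDef.mul_conjTranspose_self _ ?_
    exact Matrix.vecMul_injective_iff.2 hu
  refine ⟨hB, ?_⟩
  have hint : B = (Matrix.of fun i j => u i ⬝ᵥ u j).map (Int.castRingHom ℝ) := by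
    ext i j
    simp [B, dotProduct, zc]
  have hpos := hB.det_pos
  rw [hint, ← RingHom.mapMatrix_apply, ← RingHom.map_det] at hpos ⊢
  have : 0 < (Matrix.of fun i j => u i ⬝ᵥ u j).det := by simpa using hpos
  simpa using (by exact_mod_cast this : (1 : ℝ) ≤ ((Matrix.of fun i j => u i ⬝ᵥ u j).det : ℤ))

lemma frakC_pos (hd : 1 ≤ d) : 0 < frakC g := by
  obtain ⟨c, hc, hcoer⟩ := g.exists_coercive
  set c' := min c 1
  have hc' : 0 < c' := lt_min hc one_pos
  refine lt_of_lt_of_le (Real.sqrt_pos.2 (pow_pos hc' d)) (le_csInf ?_ ?_)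
  · refine ⟨_, 1, fun _ => Pi.single ⟨0, hd⟩ 1, le_rfl, hd,
      LinearIndependent.of_subsingleton 0 (zc_ne_zero ?_), rfl⟩
    simp
  rintro x ⟨s, u, -, hsd, hu, rfl⟩
  refine Real.sqrt_le_sqrt ?_
  obtain ⟨hB, hdet⟩ := one_le_det_dotProduct u hu
  set B : Matrix (Fin s) (Fin s) ℝ := Matrix.of fun i j => zc (u i) ⬝ᵥ zc (u j)
  have hAB : (g.gram (fun j => zc (u j)) - c • B).PosSemidef := by
    refine Matrix.PosSemidef.of_dotProduct_mulVec_nonneg ?_ fun x => ?_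
    · ext i j
      simp [B, PDForm.gram, g.inn_comm (zc (u j)), dotProduct_comm (zc (u j))]
    · rw [star_trivial, Matrix.sub_mulVec, dotProduct_sub, g.dotProduct_gram_mulVec,
        Matrix.smul_mulVec, dotProduct_smul, smul_eq_mul, sub_nonneg]
      have hquad : x ⬝ᵥ (B *ᵥ x) = (∑ i, x i • zc (u i)) ⬝ᵥ (∑ i, x i • zc (u i)) := by
        simp only [sum_dotProduct, dotProduct_sum, smul_dotProduct, dotProduct_smul, smul_eq_mul]
        simp only [B, dotProduct.eq_1 x, Matrix.mulVec, Matrix.of_apply, Finset.mul_sum]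
        simp only [dotProduct.eq_1 (fun j => zc (u _) ⬝ᵥ zc (u j)), Finset.mul_sum]
        refine Finset.sum_congr rfl fun i _ => Finset.sum_congr rfl fun j _ => ?_
        rw [dotProduct_comm (zc (u i))]
        ring
      rw [hquad]
      exact hcoer _
  have h := Matrix.PosDef.pow_mul_det_le_det hc.le hB hAB
  calc c' ^ d ≤ c' ^ s := pow_le_pow_of_le_one hc'.le (min_le_right _ _) hsd
    _ ≤ c ^ s := pow_le_pow_left₀ hc'.le (min_le_left _ _) s
    _ ≤ c ^ s * B.det := le_mul_of_one_le_right (by positivity) hdet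
    _ ≤ _ := h

end Volume

section Rank

variable {d : ℕ}

/-- The inclusion `ℤ^d → ℝ^d` as a linear map. -/
def zcLin (d : ℕ) : (Fin d → ℤ) →ₗ[ℤ] (Fin d → ℝ) where
  toFun := zc
  map_add' x y := by funext i; simp [zc]
  map_smul' c x := by funext i; simp [zc]

lemma zc_neg (x : Fin d → ℤ) : zc (-x) = -zc x := map_neg (zcLin d) x

/-- The rank of a submodule of `ℤ^d` is the dimension of its real span. -/
lemma finrank_span_zc (M : Submodule ℤ (Fin d → ℤ)) :
    Module.finrank ℝ (Submodule.span ℝ (zc '' (M : Set (Fin d → ℤ)))) = zrank M := by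
  let b := Module.finBasis ℤ M
  have hli : LinearIndependent ℝ fun i => zc (b i : Fin d → ℤ) := by
    have h : LinearIndependent ℤ fun i => (b i : Fin d → ℤ) :=
      b.linearIndependent.map' M.subtype M.ker_subtype
    have hcomp : (fun i => zc (b i : Fin d → ℤ)) =
        fun i => algebraMap ℤ ℝ ∘ (fun i => (b i : Fin d → ℤ)) i := by
      funext i j
      simp [zc]
    rw [hcomp]
    exact (linearIndependent_algebraMap_comp_iff (R := ℤ) (S := ℝ)).2 h
  have hspan : Submodule.span ℝ (zc '' (M : Set (Fin d → ℤ))) =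
      Submodule.span ℝ (Set.range fun i => zc (b i : Fin d → ℤ)) := by
    refine le_antisymm (Submodule.span_le.2 ?_) (Submodule.span_mono ?_)
    · rintro _ ⟨k, hk, rfl⟩
      have hrepr : ∑ i, b.repr ⟨k, hk⟩ i • (b i : Fin d → ℤ) = k := by
        have h := congrArg M.subtype (b.sum_repr ⟨k, hk⟩)
        simp only [map_sum, map_smul] at h
        exact h
      have hsum : zc k = ∑ i, ((b.repr ⟨k, hk⟩ i : ℤ) : ℝ) • zc (b i : Fin d → ℤ) := by
        have h := congrArg (zcLin d) hrepr
        simp only [map_sum, map_smul, ← Int.cast_smul_eq_zsmul ℝ] at h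
        exact h.symm
      rw [hsum]
      exact Submodule.sum_mem _ fun i _ =>
        Submodule.smul_mem _ _ (Submodule.subset_span ⟨i, rfl⟩)
    · rintro _ ⟨i, rfl⟩
      exact ⟨_, (b i).2, rfl⟩
  rw [hspan, finrank_span_eq_card hli, Fintype.card_fin, zrank]

/-- Linearly independent vectors of `M`, as many as the rank of `M`, span the real span of `M`. -/
lemma span_range_eq_of_zrank {M : Submodule ℤ (Fin d → ℤ)} {s : ℕ} (hM : zrank M = s)
    {l : Fin s → (Fin d → ℤ)} (hl : ∀ j, l j ∈ M) (hli : LinearIndependent ℝ fun j => zc (l j)) :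
    Submodule.span ℝ (Set.range fun j => zc (l j)) =
      Submodule.span ℝ (zc '' (M : Set (Fin d → ℤ))) := by
  refine Submodule.eq_of_le_of_finrank_eq (Submodule.span_mono ?_) ?_
  · rintro _ ⟨i, rfl⟩
    exact ⟨_, hl i, rfl⟩
  · rw [finrank_span_eq_card hli, finrank_span_zc, hM, Fintype.card_fin]

/-- The saturated submodule generated by a family of lattice vectors. -/
def satSpan {s : ℕ} (l : Fin s → (Fin d → ℤ)) : Submodule ℤ (Fin d → ℤ) :=
  ((Submodule.span ℝ (Set.range fun j => zc (l j))).restrictScalars ℤ).comap (zcLin d)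

lemma mem_satSpan {s : ℕ} (l : Fin s → (Fin d → ℤ)) (j : Fin s) : l j ∈ satSpan l :=
  Submodule.subset_span ⟨j, rfl⟩

lemma span_zc_satSpan {s : ℕ} (l : Fin s → (Fin d → ℤ)) :
    Submodule.span ℝ (zc '' (satSpan l : Set (Fin d → ℤ))) =
      Submodule.span ℝ (Set.range fun j => zc (l j)) := by
  refine le_antisymm (Submodule.span_le.2 ?_) (Submodule.span_mono ?_)
  · rintro _ ⟨k, hk, rfl⟩
    exact hk
  · rintro _ ⟨i, rfl⟩
    exact ⟨_, mem_satSpan l i, rfl⟩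

lemma isSat_satSpan {s : ℕ} (l : Fin s → (Fin d → ℤ)) : IsSat (satSpan l) := by
  intro k hk
  rw [span_zc_satSpan] at hk
  exact hk

lemma zrank_satSpan {s : ℕ} {l : Fin s → (Fin d → ℤ)}
    (hli : LinearIndependent ℝ fun j => zc (l j)) : zrank (satSpan l) = s := by
  rw [← finrank_span_zc, span_zc_satSpan, finrank_span_eq_card hli, Fintype.card_fin]

end Rank

section Comparison

/-- Quantities at least one whose difference is sublinear are comparable. -/
lemma exists_comparison {a A : ℝ} (ha₀ : 0 ≤ a) (ha₁ : a < 1) (hA : 0 ≤ A) :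
    ∃ K, 1 ≤ K ∧ ∀ P Q : ℝ, 1 ≤ P → 1 ≤ Q → |P - Q| ≤ A * (P ^ a + Q ^ a) → P ≤ K * Q := by
  have hr : 0 ≤ (4 * A) ^ (1 / (1 - a)) := by positivity
  refine ⟨2 + (4 * A) ^ (1 / (1 - a)), by linarith, fun P Q hP hQ h => ?_⟩
  by_cases hPQ : P ≤ 2 * Q
  · nlinarith
  push Not at hPQ
  have hP0 : 0 < P := by linarith
  have hQa : Q ^ a ≤ P ^ a := Real.rpow_le_rpow (by linarith) (by linarith) ha₀
  have h₁ : P ≤ 4 * A * P ^ a := by nlinarith [le_abs_self (P - Q)]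
  have h₂ : P ^ (1 - a) ≤ 4 * A := by
    rw [Real.rpow_sub hP0, Real.rpow_one]
    exact (div_le_iff₀ (Real.rpow_pos_of_pos hP0 a)).2 h₁
  have h₃ : P ≤ (4 * A) ^ (1 / (1 - a)) := by
    calc P = (P ^ (1 - a)) ^ (1 / (1 - a)) := by
          rw [← Real.rpow_mul hP0.le, mul_one_div_cancel (by linarith), Real.rpow_one]
      _ ≤ _ := Real.rpow_le_rpow (by positivity) h₂ (by
          rw [one_div]; exact inv_nonneg.2 (by linarith))
  nlinarith

/-- Powers with exponent at most one preserve comparability with the same constant. -/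
lemma rpow_le_mul_rpow {K P R a b : ℝ} (hK : 1 ≤ K) (hP : 1 ≤ P) (hR : 0 ≤ R) (ha₀ : 0 ≤ a)
    (ha₁ : a ≤ 1) (hab : a ≤ b) (h : R ≤ K * P) : R ^ a ≤ K * P ^ b := by
  calc R ^ a ≤ (K * P) ^ a := Real.rpow_le_rpow hR h ha₀
    _ = K ^ a * P ^ a := Real.mul_rpow (by linarith) (by linarith)
    _ ≤ K ^ (1 : ℝ) * P ^ b := by
        refine mul_le_mul (Real.rpow_le_rpow_of_exponent_le hK ha₁)
          (Real.rpow_le_rpow_of_exponent_le hP hab) (by positivity) (by positivity)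
    _ = K * P ^ b := by rw [Real.rpow_one]

/-- Comparability along a chain of four quantities with sublinear consecutive differences. -/
lemma exists_comparison_chain {a b A B : ℝ} (ha₀ : 0 ≤ a) (ha₁ : a < 1) (hb₀ : 0 ≤ b)
    (hb₁ : b < 1) (hA : 0 ≤ A) (hB : 0 ≤ B) :
    ∃ K, 1 ≤ K ∧ ∀ P Q W R : ℝ, 1 ≤ P → 1 ≤ Q → 1 ≤ W → 1 ≤ R →
      |Q - P| ≤ B * (Q ^ b + P ^ b) → |W - Q| ≤ A * (W ^ a + Q ^ a) →
      |R - W| ≤ A * (R ^ a + W ^ a) → Q ≤ K * P ∧ W ≤ K * P ∧ R ≤ K * P := by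
  obtain ⟨K₁, hK₁, h₁⟩ := exists_comparison hb₀ hb₁ hB
  obtain ⟨K₂, hK₂, h₂⟩ := exists_comparison ha₀ ha₁ hA
  have hK₂₁ : K₁ ≤ K₂ * K₁ := le_mul_of_one_le_left (by linarith) hK₂
  have hK₂₂ : K₂ * K₁ ≤ K₂ * (K₂ * K₁) := le_mul_of_one_le_left (by linarith) hK₂
  refine ⟨K₂ * (K₂ * K₁), by linarith, fun P Q W R hP hQ hW hR hQP hWQ hRW => ?_⟩
  have hQ' := h₁ Q P hQ hP hQP
  have hW' : W ≤ K₂ * K₁ * P := by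
    calc W ≤ K₂ * Q := h₂ W Q hW hQ hWQ
      _ ≤ K₂ * (K₁ * P) := by gcongr
      _ = K₂ * K₁ * P := by ring
  have hR' : R ≤ K₂ * (K₂ * K₁) * P := by
    calc R ≤ K₂ * W := h₂ R W hR hW hRW
      _ ≤ K₂ * (K₂ * K₁ * P) := by gcongr
      _ = K₂ * (K₂ * K₁) * P := by ring
  refine ⟨hQ'.trans ?_, hW'.trans ?_, hR'⟩
  · exact mul_le_mul_of_nonneg_right (by linarith) (by linarith)
  · exact mul_le_mul_of_nonneg_right hK₂₂ (by linarith)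

end Comparison

section Zones

variable {d : ℕ}

/-- At a point resonant with a full-rank tuple of `M`, the pairing with the real span of `M` is
small. -/
lemma ZoneData.abs_inn_le_of_resonant (Z : ZoneData d) {t : ℕ} {A : ℝ} (hA : 1 ≤ A)
    (hε : 0 ≤ Z.ε) (hτ : 0 ≤ Z.τ) (hF : 0 < frakC Z.g)
    (hC : ∀ j < t + 1, Z.Cs j ≤ A) (hD : ∀ j < t + 1, Z.Ds j ≤ A)
    {M : Submodule ℤ (Fin d → ℤ)} (hM : zrank M = t + 1) {l : Fin (t + 1) → (Fin d → ℤ)}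
    (hl : ∀ j, l j ∈ M) (hli : LinearIndependent ℝ fun j => zc (l j)) {y : Fin d → ℝ}
    (hres : ∀ j : Fin (t + 1),
      |Z.g.inn y (zc (l j))| ≤
        Z.Cs j * (Z.g.jap y) ^ (Z.δs j) * (Z.g.nrm (zc (l j))) ^ (-Z.τ) ∧
      Z.g.nrm (zc (l j)) ≤ Z.Ds j * (Z.g.jap y) ^ Z.ε)
    {w : Fin d → ℝ} (hw : w ∈ Submodule.span ℝ (zc '' (M : Set (Fin d → ℤ)))) :
    |Z.g.inn y w| ≤
      ((t + 1 : ℕ) * ((t + 1).factorial * A ^ t / frakC Z.g) * (A * frakC Z.g ^ (-Z.τ))) *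
        (Z.g.jap y) ^ (Z.δs t + t * Z.ε) * Z.g.nrm w := by
  set P := Z.g.jap y
  set F := frakC Z.g
  have hP : 1 ≤ P := Z.g.one_le_jap y
  have hN : ∀ j, Z.g.nrm (zc (l j)) ≤ A * P ^ Z.ε := fun j =>
    (hres j).2.trans (mul_le_mul_of_nonneg_right (hD j j.2) (by positivity))
  have hX : ∀ j, |Z.g.inn y (zc (l j))| ≤ A * F ^ (-Z.τ) * P ^ (Z.δs t) := by
    intro j
    have hne : l j ≠ 0 := by
      intro h
      refine hli.ne_zero j ?_
      simp only [h]
      funext i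
      simp [zc]
    have hnrm : F ≤ Z.g.nrm (zc (l j)) := frakC_le_nrm Z.g hne
    have hjt : (j : ℝ) ≤ t := by exact_mod_cast Nat.lt_succ_iff.1 j.2
    have hδ : Z.δs j ≤ Z.δs t := by
      unfold ZoneData.δs
      gcongr
    calc |Z.g.inn y (zc (l j))|
        ≤ Z.Cs j * P ^ (Z.δs j) * (Z.g.nrm (zc (l j))) ^ (-Z.τ) := (hres j).1
      _ ≤ A * P ^ (Z.δs t) * F ^ (-Z.τ) := by
          have h1 : P ^ (Z.δs j) ≤ P ^ (Z.δs t) := Real.rpow_le_rpow_of_exponent_le hP hδ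
          have h2 : (Z.g.nrm (zc (l j))) ^ (-Z.τ) ≤ F ^ (-Z.τ) :=
            Real.rpow_le_rpow_of_nonpos hF hnrm (by linarith)
          have h3 := hC j j.2
          have h4 := Z.g.nrm_nonneg (zc (l j))
          gcongr
      _ = _ := by ring
  rw [← span_range_eq_of_zrank hM hl hli] at hw
  have h := Z.g.abs_inn_le_of_mem_span hF (frakC_le_gvol Z.g l (by omega) hli) hN hX hw
  refine h.trans (le_of_eq ?_)
  rw [Nat.add_sub_cancel, mul_pow, ← Real.rpow_mul_natCast (by linarith), Real.rpow_add (by linarith),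
    mul_comm (t : ℝ) Z.ε]
  ring

lemma xik_sub_xik (κ : Fin d → ℝ) (ξ η k l : Fin d → ℤ) :
    xik κ ξ k - xik κ η l = zc (ξ - η) + (1 / 2 : ℝ) • (zc k + zc (-l)) := by
  funext i
  simp [xik, zc]
  ring

lemma xik_add_neg (κ : Fin d → ℝ) (ξ k : Fin d → ℤ) : xik κ (ξ + k) (-k) = xik κ ξ k := by
  funext i
  simp [xik]
  ring

/-- Two points of one full-rank resonant zone that differ by an element of the module are close. -/
lemma PDForm.nrm_sub_le_of_abs_inn_le (g : PDForm d) {x y : Fin d → ℝ} {X Y : ℝ}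
    (hX : |g.inn x (x - y)| ≤ X * g.nrm (x - y)) (hY : |g.inn y (x - y)| ≤ Y * g.nrm (x - y))
    (h₀ : 0 ≤ X + Y) : g.nrm (x - y) ≤ X + Y := by
  have h : g.nrm (x - y) ^ 2 ≤ (X + Y) * g.nrm (x - y) := by
    rw [g.nrm_sq, g.inn_sub_left]
    linarith [le_abs_self (g.inn x (x - y)), neg_abs_le (g.inn y (x - y))]
  rcases (g.nrm_nonneg (x - y)).eq_or_lt with h0 | h0
  · rw [← h0]; exact h₀
  · nlinarith

/-- Every vector resonant, with constant `A`, near a point of the extension of a block of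
order `t + 1` belongs to the module of that block. -/
def ZoneData.Absorbs (Z : ZoneData d) (t : ℕ) (A : ℝ) : Prop :=
  ∀ M : Submodule ℤ (Fin d → ℤ), IsSat M → zrank M = t + 1 →
    ∀ b ∈ Z.BM (t + 1) M, ∀ ζ ∈ Z.ZM (t + 1) M, ζ - b ∈ M →
    ∀ k k' h : Fin d → ℤ,
      Z.g.nrm (zc k) ≤ (Z.g.jap (xik Z.κ ζ k)) ^ Z.ε →
      Z.g.nrm (zc k') ≤ A * (Z.g.jap (xik Z.κ (ζ + k) k')) ^ Z.ε →
      |Z.g.inn (xik Z.κ (ζ + k) k') (zc h)| ≤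
        A * (Z.g.jap (xik Z.κ (ζ + k) k')) ^ (Z.δs t) * (Z.g.nrm (zc h)) ^ (-Z.τ) →
      Z.g.nrm (zc h) ≤ A * (Z.g.jap (xik Z.κ (ζ + k) k')) ^ Z.ε →
      h ∈ M

set_option maxHeartbeats 1000000 in
/-- With the next constants large enough, every vector resonant near a point of `B + M` lies
in `M`. -/
lemma exists_absorbing_constant {δ ε τ : ℝ} (hpar : ParamsOK d δ ε τ) {t : ℕ} (ht : t + 1 ≤ d)
    {F A : ℝ} (hF : 0 < F) (hA : 1 ≤ A) :
    ∃ K, 1 ≤ K ∧ ∀ Z : ZoneData d, Z.δ = δ → Z.ε = ε → Z.τ = τ → frakC Z.g = F →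
      (∀ j < t + 1, Z.Cs j ≤ A) → (∀ j < t + 1, Z.Ds j ≤ A) →
      K ≤ Z.Cs (t + 1) → K ≤ Z.Ds (t + 1) →
      Z.Absorbs t A := by
  obtain ⟨hd, hδ0, hδ1, hε, hτ, hsum, hετ⟩ := hpar
  have hdR : (1 : ℝ) ≤ d := by exact_mod_cast hd
  have htd : (t : ℝ) + 1 ≤ d := by exact_mod_cast ht
  have ht0 : (0 : ℝ) ≤ t := t.cast_nonneg
  have hτ0 : 0 < τ := by linarith
  set σ : ℝ := δ + t * ((d + τ + 1) * ε) with hσ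
  set β : ℝ := σ + t * ε with hβ
  have hσ0 : 0 ≤ σ := by positivity
  have hβ0 : 0 ≤ β := by positivity
  have hσβ : σ ≤ β := by rw [hβ]; nlinarith
  have hεβ : ε ≤ β := by
    have h1 : ε ≤ δ := by nlinarith
    have h2 : δ ≤ σ := by rw [hσ]; nlinarith [mul_nonneg ht0 (by positivity : 0 ≤ (d + τ + 1) * ε)]
    linarith
  have hstep : β + ε * (1 + τ) ≤ σ + (d + τ + 1) * ε := by
    rw [hβ]; nlinarith
  have hβ1 : β < 1 := by
    have h1 : σ + (d + τ + 1) * ε ≤ δ + d * ((d + τ + 1) * ε) := by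
      rw [hσ]
      have := mul_le_mul_of_nonneg_right htd (by positivity : 0 ≤ (d + τ + 1) * ε)
      linarith
    have h2 : 0 ≤ ε * (1 + τ) := by positivity
    linarith
  set K₁ : ℝ := (t + 1 : ℕ) * ((t + 1).factorial * A ^ t / F) * (A * F ^ (-τ)) with hK₁
  have hK₁0 : 0 ≤ K₁ := by positivity
  obtain ⟨K₂, hK₂, hchain⟩ := exists_comparison_chain hε.le (hεβ.trans_lt hβ1) hβ0 hβ1
    (zero_le_one.trans hA) hK₁0
  set K₃ : ℝ := K₁ * (K₂ + 1) + A * (2 * K₂) + A * (2 * K₂) with hK₃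
  have hK₃0 : 0 ≤ K₃ := by positivity
  set K₄ : ℝ := (A * K₂) ^ (1 + τ) with hK₄
  have hK₄0 : 0 ≤ K₄ := by positivity
  have hAK : 1 ≤ A * K₂ := one_le_mul_of_one_le_of_one_le hA hK₂
  refine ⟨A * K₂ + K₃ * K₄, by nlinarith [mul_nonneg hK₃0 hK₄0], ?_⟩
  rintro Z rfl rfl rfl rfl hC hD hCs hDs M hsat hM b hb ζ hζ hζb k k' h hk hk' hh₁ hh₂
  by_contra hhM
  obtain ⟨⟨hbE, _, l, hlM, hlli, hl⟩, hbnot⟩ := hb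
  obtain ⟨-, _, m, hmM, hmli, hm⟩ := hζ
  change ∀ j : Fin (t + 1), |Z.g.inn (xik Z.κ b (l 0)) (zc (l j))| ≤
    Z.Cs j * (Z.g.jap (xik Z.κ b (l 0))) ^ (Z.δs j) * (Z.g.nrm (zc (l j))) ^ (-Z.τ) ∧
      Z.g.nrm (zc (l j)) ≤ Z.Ds j * (Z.g.jap (xik Z.κ b (l 0))) ^ Z.ε at hl
  change ∀ j : Fin (t + 1), |Z.g.inn (xik Z.κ ζ (m 0)) (zc (m j))| ≤
    Z.Cs j * (Z.g.jap (xik Z.κ ζ (m 0))) ^ (Z.δs j) * (Z.g.nrm (zc (m j))) ^ (-Z.τ) ∧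
      Z.g.nrm (zc (m j)) ≤ Z.Ds j * (Z.g.jap (xik Z.κ ζ (m 0))) ^ Z.ε at hm
  have hδs : Z.δs t = σ := rfl
  set y₀ := xik Z.κ b (l 0) with hy₀
  set y₁ := xik Z.κ ζ (m 0) with hy₁
  set y₂ := xik Z.κ ζ k with hy₂
  set y := xik Z.κ (ζ + k) k' with hy
  set P := Z.g.jap y₀ with hPdef
  set Q := Z.g.jap y₁
  set W := Z.g.jap y₂
  set R := Z.g.jap y
  have hP : 1 ≤ P := Z.g.one_le_jap _
  have hQ : 1 ≤ Q := Z.g.one_le_jap _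
  have hW : 1 ≤ W := Z.g.one_le_jap _
  have hR : 1 ≤ R := Z.g.one_le_jap _
  have hmem : ∀ {x}, x ∈ M → zc x ∈ Submodule.span ℝ (zc '' (M : Set (Fin d → ℤ))) :=
    fun hx => Submodule.subset_span ⟨_, hx, rfl⟩
  have hv : y₁ - y₀ ∈ Submodule.span ℝ (zc '' (M : Set (Fin d → ℤ))) := by
    rw [hy₀, hy₁, xik_sub_xik]
    exact Submodule.add_mem _ (hmem hζb) (Submodule.smul_mem _ _
      (Submodule.add_mem _ (hmem (hmM 0)) (hmem (M.neg_mem (hlM 0)))))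
  have hd₁ : Z.g.nrm (y₁ - y₀) ≤ K₁ * (Q ^ β + P ^ β) := by
    have h₀ := Z.abs_inn_le_of_resonant hA hε.le hτ0.le hF hC hD hM hlM hlli hl hv
    have h₁ := Z.abs_inn_le_of_resonant hA hε.le hτ0.le hF hC hD hM hmM hmli hm hv
    rw [mul_add]
    exact Z.g.nrm_sub_le_of_abs_inn_le h₁ h₀ (by positivity)
  have hhalf : ∀ x z : Fin d → ℝ,
      Z.g.nrm ((1 / 2 : ℝ) • (x + z)) ≤ Z.g.nrm x + Z.g.nrm z := fun x z => by
    rw [Z.g.nrm_half_smul]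
    linarith [Z.g.nrm_add_le x z, Z.g.nrm_nonneg (x + z)]
  have hd₂ : Z.g.nrm (y₂ - y₁) ≤ A * (W ^ Z.ε + Q ^ Z.ε) := by
    rw [hy₁, hy₂, xik_sub_xik, sub_self, show zc (0 : Fin d → ℤ) = 0 from map_zero (zcLin d),
      zero_add]
    refine (hhalf _ _).trans ?_
    rw [zc_neg, Z.g.nrm_neg, mul_add]
    refine add_le_add (hk.trans (le_mul_of_one_le_left (by positivity) hA)) ?_
    exact (hm 0).2.trans (mul_le_mul_of_nonneg_right (hD _ (by simp)) (by positivity))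
  have hd₃ : Z.g.nrm (y - y₂) ≤ A * (R ^ Z.ε + W ^ Z.ε) := by
    rw [hy, hy₂, ← xik_add_neg Z.κ ζ k, xik_sub_xik, sub_self,
      show zc (0 : Fin d → ℤ) = 0 from map_zero (zcLin d), zero_add, neg_neg]
    refine (hhalf _ _).trans ?_
    rw [mul_add]
    exact add_le_add hk' (hk.trans (le_mul_of_one_le_left (by positivity) hA))
  obtain ⟨hQP, hWP, hRP⟩ := hchain P Q W R hP hQ hW hR
    ((Z.g.abs_jap_sub_le _ _).trans hd₁) ((Z.g.abs_jap_sub_le _ _).trans hd₂)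
    ((Z.g.abs_jap_sub_le _ _).trans hd₃)
  have hε1 : Z.ε ≤ 1 := (hεβ.trans_lt hβ1).le
  have hdist : Z.g.nrm (y - y₀) ≤ K₃ * P ^ β := by
    have hsplit : y - y₀ = (y - y₂) + ((y₂ - y₁) + (y₁ - y₀)) := by abel
    have h₁ := Z.g.nrm_add_le (y - y₂) ((y₂ - y₁) + (y₁ - y₀))
    have h₂ := Z.g.nrm_add_le (y₂ - y₁) (y₁ - y₀)
    have hQβ := rpow_le_mul_rpow hK₂ hP (by linarith) hβ0 hβ1.le le_rfl hQP
    have hQε := rpow_le_mul_rpow hK₂ hP (by linarith) hε.le hε1 hεβ hQP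
    have hWε := rpow_le_mul_rpow hK₂ hP (by linarith) hε.le hε1 hεβ hWP
    have hRε := rpow_le_mul_rpow hK₂ hP (by linarith) hε.le hε1 hεβ hRP
    calc Z.g.nrm (y - y₀) ≤ A * (R ^ Z.ε + W ^ Z.ε) + (A * (W ^ Z.ε + Q ^ Z.ε) +
          K₁ * (Q ^ β + P ^ β)) := by rw [hsplit]; linarith
      _ ≤ A * (K₂ * P ^ β + K₂ * P ^ β) + (A * (K₂ * P ^ β + K₂ * P ^ β) +
          K₁ * (K₂ * P ^ β + P ^ β)) := by gcongr
      _ = K₃ * P ^ β := by rw [hK₃]; ring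
  have hh0 : h ≠ 0 := by rintro rfl; exact hhM M.zero_mem
  have hnh : 0 < Z.g.nrm (zc h) := hF.trans_le (frakC_le_nrm Z.g hh0)
  have hnhP : Z.g.nrm (zc h) ≤ A * K₂ * P ^ Z.ε := by
    have := rpow_le_mul_rpow hK₂ hP (by linarith) hε.le hε1 le_rfl hRP
    calc Z.g.nrm (zc h) ≤ A * R ^ Z.ε := hh₂
      _ ≤ A * (K₂ * P ^ Z.ε) := by gcongr
      _ = _ := by ring
  have hδsucc : Z.δs (t + 1) = σ + (d + Z.τ + 1) * Z.ε := by
    rw [ZoneData.δs, hσ]; push_cast; ring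
  have hnh' : Z.g.nrm (zc h) ≤ K₄ * P ^ (Z.ε * (1 + Z.τ)) * Z.g.nrm (zc h) ^ (-Z.τ) := by
    calc Z.g.nrm (zc h) = Z.g.nrm (zc h) ^ (1 + Z.τ) * Z.g.nrm (zc h) ^ (-Z.τ) := by
          rw [← Real.rpow_add hnh, add_neg_cancel_right, Real.rpow_one]
      _ ≤ (A * K₂ * P ^ Z.ε) ^ (1 + Z.τ) * Z.g.nrm (zc h) ^ (-Z.τ) := by gcongr
      _ = _ := by
          rw [Real.mul_rpow (by positivity) (by positivity), ← Real.rpow_mul (by linarith)]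
  have hinn : |Z.g.inn y₀ (zc h)| ≤
      Z.Cs (t + 1) * P ^ (Z.δs (t + 1)) * Z.g.nrm (zc h) ^ (-Z.τ) := by
    have hRσ : R ^ σ ≤ K₂ * P ^ (Z.δs (t + 1)) :=
      rpow_le_mul_rpow hK₂ hP (by linarith) hσ0 (by linarith)
        (by rw [hδsucc]; nlinarith [mul_nonneg (by linarith : 0 ≤ d + Z.τ + 1) hε.le]) hRP
    have hPβ : P ^ β * P ^ (Z.ε * (1 + Z.τ)) ≤ P ^ (Z.δs (t + 1)) := by
      rw [← Real.rpow_add (by linarith), hδsucc]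
      exact Real.rpow_le_rpow_of_exponent_le hP hstep
    have htri : |Z.g.inn y₀ (zc h)| ≤
        |Z.g.inn y (zc h)| + Z.g.nrm (y - y₀) * Z.g.nrm (zc h) := by
      have h₁ := Z.g.abs_inn_le (y - y₀) (zc h)
      rw [Z.g.inn_sub_left, abs_sub_comm] at h₁
      linarith [abs_sub_abs_le_abs_sub (Z.g.inn y₀ (zc h)) (Z.g.inn y (zc h))]
    have hn0 := Z.g.nrm_nonneg (y - y₀)
    calc |Z.g.inn y₀ (zc h)|
        ≤ A * R ^ σ * Z.g.nrm (zc h) ^ (-Z.τ) + (K₃ * P ^ β) *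
          (K₄ * P ^ (Z.ε * (1 + Z.τ)) * Z.g.nrm (zc h) ^ (-Z.τ)) :=
          htri.trans (add_le_add hh₁ (mul_le_mul hdist hnh' hnh.le (by positivity)))
      _ = A * R ^ σ * Z.g.nrm (zc h) ^ (-Z.τ) + (K₃ * K₄) * (P ^ β * P ^ (Z.ε * (1 + Z.τ))) *
          Z.g.nrm (zc h) ^ (-Z.τ) := by ring
      _ ≤ A * (K₂ * P ^ (Z.δs (t + 1))) * Z.g.nrm (zc h) ^ (-Z.τ) +
          (K₃ * K₄) * P ^ (Z.δs (t + 1)) * Z.g.nrm (zc h) ^ (-Z.τ) := by gcongr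
      _ = (A * K₂ + K₃ * K₄) * P ^ (Z.δs (t + 1)) * Z.g.nrm (zc h) ^ (-Z.τ) := by ring
      _ ≤ _ := by gcongr
  have hnD : Z.g.nrm (zc h) ≤ Z.Ds (t + 1) * P ^ Z.ε :=
    hnhP.trans (mul_le_mul_of_nonneg_right
      (by linarith [mul_nonneg hK₃0 hK₄0]) (by positivity))
  let l' : Fin (t + 2) → (Fin d → ℤ) := Fin.snoc l h
  have hl'c : ∀ j : Fin (t + 1), l' j.castSucc = l j := fun j => by simp [l']
  have hl'l : l' (Fin.last _) = h := by simp [l']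
  have hspan := span_range_eq_of_zrank hM hlM hlli
  have hli' : LinearIndependent ℝ fun j => zc (l' j) := by
    have hcomp : (fun j => zc (l' j)) = Fin.snoc (fun j => zc (l j)) (zc h) := by
      funext j
      refine Fin.lastCases ?_ (fun j => ?_) j
      · simp [l']
      · simp [l']
    rw [hcomp, linearIndependent_finSnoc]
    refine ⟨hlli, fun hmem => hhM (hsat h ?_)⟩
    rwa [hspan] at hmem
  refine hbnot (Set.mem_iUnion₂.2 ⟨satSpan l', ⟨isSat_satSpan l', zrank_satSpan hli'⟩, hbE,
    Nat.succ_pos _, l', mem_satSpan l', hli', fun j => ?_⟩)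
  have hzero : l' ⟨0, Nat.succ_pos _⟩ = l 0 := hl'c 0
  rw [hzero, ← hy₀, ← hPdef]
  refine Fin.lastCases ?_ (fun j => ?_) j
  · rw [hl'l]
    exact ⟨hinn, hnD⟩
  · rw [hl'c]
    exact hl j

end Zones

namespace ZoneData

variable {d : ℕ} (Z : ZoneData d)

lemma mem_EM_iff {s : ℕ} {M : Submodule ℤ (Fin d → ℤ)} {ξ : Fin d → ℤ} :
    ξ ∈ Z.EM s M ↔ (∃ b ∈ Z.BM s M, ∃ m ∈ M, ξ = b + m) ∧ ξ ∈ Z.ZM s M ∧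
      ∀ r, 1 ≤ r → r < s → ∀ M' : Submodule ℤ (Fin d → ℤ),
        IsSat M' → zrank M' = r → ξ ∉ Z.EM r M' := by
  rw [EM]
  rfl

/-- A resonant vector at `ζ + k/2` places `ζ + k` in a first-order zone. -/
lemma exists_mem_ZM_one (hC : Z.Cs 0 = 1) (hD : Z.Ds 0 = 1) {ζ k : Fin d → ℤ} (hk : k ≠ 0)
    (hE : ζ + k ∈ Z.E)
    (h₁ : |Z.g.inn (xik Z.κ ζ k) (zc k)| ≤
      (Z.g.jap (xik Z.κ ζ k)) ^ Z.δ * (Z.g.nrm (zc k)) ^ (-Z.τ))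
    (h₂ : Z.g.nrm (zc k) ≤ (Z.g.jap (xik Z.κ ζ k)) ^ Z.ε) :
    ∃ M : Submodule ℤ (Fin d → ℤ), IsSat M ∧ zrank M = 1 ∧ ζ + k ∈ Z.ZM 1 M := by
  have hli : LinearIndependent ℝ fun j : Fin 1 => zc ((fun _ : Fin 1 => -k) j) :=
    LinearIndependent.of_subsingleton 0 (zc_ne_zero (neg_ne_zero.2 hk))
  refine ⟨satSpan fun _ : Fin 1 => -k, isSat_satSpan _, zrank_satSpan hli, hE, one_pos,
    fun _ => -k, mem_satSpan _, hli, fun j => ?_⟩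
  obtain rfl : j = 0 := Subsingleton.elim _ _
  have hinn : Z.g.inn (xik Z.κ ζ k) (-zc k) = -Z.g.inn (xik Z.κ ζ k) (zc k) := by
    simp [PDForm.inn]
  simpa [xik_add_neg, zc_neg, Z.g.nrm_neg, hC, hD, δs, hinn] using And.intro h₁ h₂

/-- A point of a first-order zone outside all extended blocks of lower order lies in some zone
of order `s`. -/
lemma exists_mem_ZM_of_notMem_EM {ξ : Fin d → ℤ} {s : ℕ}
    (h₁ : ∃ M : Submodule ℤ (Fin d → ℤ), IsSat M ∧ zrank M = 1 ∧ ξ ∈ Z.ZM 1 M)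
    (hE : ∀ r, 1 ≤ r → r < s → ∀ M : Submodule ℤ (Fin d → ℤ),
      IsSat M → zrank M = r → ξ ∉ Z.EM r M) {r : ℕ} (hr : 1 ≤ r) (hrs : r ≤ s) :
    ∃ M : Submodule ℤ (Fin d → ℤ), IsSat M ∧ zrank M = r ∧ ξ ∈ Z.ZM r M := by
  induction r, hr using Nat.le_induction with
  | base => exact h₁
  | succ r hr ih =>
    obtain ⟨M, hsat, hM, hξ⟩ := ih (by omega)
    by_contra hno
    push Not at hno
    refine hE r hr hrs M hsat hM (Z.mem_EM_iff.2 ⟨⟨ξ, ⟨hξ, fun hmem => ?_⟩, 0, M.zero_mem,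
      (add_zero ξ).symm⟩, hξ, fun r' h1 h2 => hE r' h1 (h2.trans hrs)⟩)
    obtain ⟨M', hM', hmem'⟩ := Set.mem_iUnion₂.1 hmem
    exact hno M' hM'.1 hM'.2 hmem'

/-- If all blocks absorb their resonant vectors, the extended blocks are invariant. -/
lemma mem_EM_of_absorbs (hε : 0 ≤ Z.ε) (hτ : 0 ≤ Z.τ) {A : ℕ → ℝ} (hA0 : A 0 = 1)
    (hA : Monotone A) (hC : Z.Cs = A) (hD : Z.Ds = A)
    (habs : ∀ t, t + 1 ≤ d → Z.Absorbs t (A t)) {s : ℕ} (hs : 1 ≤ s) (hsd : s ≤ d)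
    {M : Submodule ℤ (Fin d → ℤ)} (hsat : IsSat M) (hM : zrank M = s) {ζ k : Fin d → ℤ}
    (hζ : ζ ∈ Z.EM s M) (hk : k ≠ 0) (hE : ζ + k ∈ Z.E)
    (h₁ : |Z.g.inn (xik Z.κ ζ k) (zc k)| ≤
      (Z.g.jap (xik Z.κ ζ k)) ^ Z.δ * (Z.g.nrm (zc k)) ^ (-Z.τ))
    (h₂ : Z.g.nrm (zc k) ≤ (Z.g.jap (xik Z.κ ζ k)) ^ Z.ε) :
    k ∈ M ∧ ζ + k ∈ Z.EM s M := by
  induction s using Nat.strong_induction_on generalizing M ζ k with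
  | _ s ih =>
  obtain ⟨t, rfl⟩ : ∃ t, s = t + 1 := ⟨s - 1, by omega⟩
  have hone : ∀ n, 1 ≤ A n := fun n => hA0 ▸ hA n.zero_le
  have hδs : Monotone Z.δs := fun i j hij => by
    have hij' : (i : ℝ) ≤ j := by exact_mod_cast hij
    have : 0 ≤ (d + Z.τ + 1) * Z.ε := by positivity
    simp only [δs]
    gcongr
  have hbound : ∀ i ≤ t, ∀ (x : Fin d → ℝ) (y : Fin d → ℝ),
      A i * Z.g.jap x ^ Z.δs i * Z.g.nrm y ^ (-Z.τ) ≤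
        A t * Z.g.jap x ^ Z.δs t * Z.g.nrm y ^ (-Z.τ) := fun i hi x y => by
    have hx := Z.g.one_le_jap x
    exact mul_le_mul_of_nonneg_right (mul_le_mul (hA hi)
      (Real.rpow_le_rpow_of_exponent_le hx (hδs hi)) (by positivity)
      (by linarith [hone t])) (Real.rpow_nonneg (Z.g.nrm_nonneg y) _)
  have hbound' : ∀ i ≤ t, ∀ x : Fin d → ℝ,
      A i * Z.g.jap x ^ Z.ε ≤ A t * Z.g.jap x ^ Z.ε := fun i hi x =>
    mul_le_mul_of_nonneg_right (hA hi)
      (Real.rpow_nonneg (zero_le_one.trans (Z.g.one_le_jap x)) _)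
  have hδ0 : Z.δs 0 = Z.δ := by simp [δs]
  obtain ⟨⟨b, hb, m, hm, hζb⟩, hζZ, hζE⟩ := Z.mem_EM_iff.1 hζ
  have habsorb := habs t hsd M hsat hM b hb ζ hζZ (by rwa [hζb, add_sub_cancel_left]) k
  have hkM : k ∈ M := by
    refine habsorb (-k) k h₂ ?_ ?_ ?_
    · rw [xik_add_neg, zc_neg, Z.g.nrm_neg]
      exact h₂.trans (by simpa [hA0] using hbound' 0 t.zero_le (xik Z.κ ζ k))
    · rw [xik_add_neg]
      exact h₁.trans (by simpa [hA0, hδ0] using hbound 0 t.zero_le (xik Z.κ ζ k) (zc k))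
    · rw [xik_add_neg]
      exact h₂.trans (by simpa [hA0] using hbound' 0 t.zero_le (xik Z.κ ζ k))
  have hlow : ∀ r, 1 ≤ r → r < t + 1 → ∀ M' : Submodule ℤ (Fin d → ℤ),
      IsSat M' → zrank M' = r → ζ + k ∉ Z.EM r M' := by
    intro r hr hrt M' hsat' hM' hmem
    have hback : ζ + k + -k = ζ := add_neg_cancel_right ζ k
    have hinn : Z.g.inn (xik Z.κ ζ k) (-zc k) = -Z.g.inn (xik Z.κ ζ k) (zc k) := by
      simp [PDForm.inn]
    refine hζE r hr hrt M' hsat' hM' ?_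
    have := (ih r hrt hr (by omega) hsat' hM' hmem (neg_ne_zero.2 hk)
      (by rw [hback]; exact hζZ.1)
      (by rwa [xik_add_neg, zc_neg, Z.g.nrm_neg, hinn, abs_neg])
      (by rwa [xik_add_neg, zc_neg, Z.g.nrm_neg])).2
    rwa [hback] at this
  refine ⟨hkM, Z.mem_EM_iff.2 ⟨⟨b, hb, m + k, M.add_mem hm hkM, by rw [hζb, add_assoc]⟩, ?_,
    hlow⟩⟩
  obtain ⟨-, -, -, -, hpos, l, -, hli, hl⟩ := Z.exists_mem_ZM_of_notMem_EM
    (Z.exists_mem_ZM_one (by rw [hC, hA0]) (by rw [hD, hA0]) hk hE h₁ h₂) hlow hs le_rfl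
  rw [hC, hD] at hl
  refine ⟨hE, hpos, l, fun j => ?_, hli, by rwa [hC, hD]⟩
  have hj : (j : ℕ) ≤ t := Nat.le_of_lt_succ j.isLt
  exact habsorb _ _ h₂ ((hl _).2.trans (hbound' _ t.zero_le _))
    ((hl j).1.trans (hbound _ hj _ _)) ((hl j).2.trans (hbound' _ hj _))

end ZoneData

/-- A recursive choice of increasing constants for which every block absorbs its resonant
vectors. -/
lemma exists_absorbing_sequence {d : ℕ} {δ ε τ : ℝ} (hpar : ParamsOK d δ ε τ) {F : ℝ}
    (hF : 0 < F) :
    ∃ a : ℕ → ℝ, a 0 = 1 ∧ StrictMono a ∧ ∀ t, t + 1 ≤ d → ∀ Z : ZoneData d,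
      Z.δ = δ → Z.ε = ε → Z.τ = τ → frakC Z.g = F → Z.Cs = a → Z.Ds = a → Z.Absorbs t (a t) := by
  classical
  choose K hK₁ hK using fun (t : ℕ) (ht : t + 1 ≤ d) (A : ℝ) (hA : 1 ≤ A) =>
    exists_absorbing_constant hpar ht hF hA
  let K' : ℕ → ℝ → ℝ := fun t A => if h : t + 1 ≤ d ∧ 1 ≤ A then K t h.1 A h.2 else 1
  have hK' : ∀ t A, 1 ≤ K' t A := fun t A => by
    simp only [K']
    split_ifs
    · exact hK₁ _ _ _ _
    · exact le_rfl
  let a : ℕ → ℝ := fun n => Nat.rec 1 (fun t A => A + K' t A) n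
  have hsucc : ∀ n, a (n + 1) = a n + K' n (a n) := fun n => rfl
  have hmono : StrictMono a := strictMono_nat_of_lt_succ fun n => by
    rw [hsucc]; linarith [hK' n (a n)]
  have hone : ∀ n, 1 ≤ a n := fun n => hmono.monotone n.zero_le
  refine ⟨a, rfl, hmono, fun t ht Z hδ hε hτ hFZ hC hD => ?_⟩
  have hKt : K t ht (a t) (hone t) ≤ a (t + 1) := by
    have : K' t (a t) = K t ht (a t) (hone t) := dif_pos ⟨ht, hone t⟩
    rw [hsucc, this]; linarith [hone t]
  have hle : ∀ j < t + 1, a j ≤ a t := fun j hj => hmono.monotone (Nat.le_of_lt_succ hj)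
  exact hK t ht (a t) (hone t) Z hδ hε hτ hFZ (by rwa [hC]) (by rwa [hD]) (by rwa [hC])
    (by rwa [hD])

/-- There is a choice of the constants `C_j`, `D_j`, depending only on
`d, ε, δ, τ, 𝔠, 𝔉`, such that the extended blocks are invariant under resonant normal
forms: if `ζ ∈ E⁽ˢ⁾_M` and `k ≠ 0` satisfies the resonant support conditions at `ζ + k/2`
with `ζ + k ∈ E`, then `k ∈ M` and `ζ + k ∈ E⁽ˢ⁾_M`. -/
theorem statement1 (d : ℕ) (δ ε τ : ℝ) (hpar : ParamsOK d δ ε τ) :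
    ∃ Cfun Dfun : ℝ → ℝ → ℕ → ℝ,
      ∀ (g : PDForm d) (κ : Fin d → ℝ) (E : Set (Fin d → ℤ)),
        let Z : ZoneData d :=
          ⟨g, κ, E, δ, ε, τ, Cfun (frakc g) (frakC g), Dfun (frakc g) (frakC g)⟩
        SeqOK d Z.Cs Z.Ds ∧
        ∀ (s : ℕ) (M : Submodule ℤ (Fin d → ℤ)), s ≤ d → IsSat M → zrank M = s →
          ∀ ζ ∈ (if s = 0 then Z.Z0 else Z.EM s M),
            ∀ k : Fin d → ℤ, k ≠ 0 → ζ + k ∈ E →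
              |g.inn (xik κ ζ k) (zc k)| ≤
                (g.jap (xik κ ζ k)) ^ δ * (g.nrm (zc k)) ^ (-τ) →
              g.nrm (zc k) ≤ (g.jap (xik κ ζ k)) ^ ε →
              k ∈ M ∧ ζ + k ∈ (if s = 0 then Z.Z0 else Z.EM s M) := by
  obtain ⟨hd, -, -, hε, hτ, -, -⟩ := id hpar
  have hdR : (1 : ℝ) ≤ d := by exact_mod_cast hd
  choose a ha0 hmono habs using fun (F : ℝ) (hF : 0 < F) => exists_absorbing_sequence hpar hF
  classical
  let c : ℝ → ℝ → ℕ → ℝ := fun _ F => if h : 0 < F then a F h else 0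
  refine ⟨c, c, fun g κ E => ?_⟩
  intro Z
  have hF : 0 < frakC g := frakC_pos g hd
  have hc : c (frakc g) (frakC g) = a (frakC g) hF := dif_pos hF
  have hC : Z.Cs = a (frakC g) hF := hc
  have hD : Z.Ds = a (frakC g) hF := hc
  have hm := hmono (frakC g) hF
  have h0 := ha0 (frakC g) hF
  refine ⟨⟨by rw [hC, h0], by rw [hD, h0], fun j _ => by rw [hC]; exact hm j.lt_succ_self,
    fun j _ => by rw [hD]; exact hm j.lt_succ_self⟩, ?_⟩
  intro s M hsd hsat hM ζ hζ k hk hE h₁ h₂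
  rcases Nat.eq_zero_or_pos s with rfl | hs
  · rw [if_pos rfl] at hζ
    exact absurd h₁ (not_le.2 (hζ.2 k hk h₂))
  · rw [if_neg hs.ne'] at hζ ⊢
    exact Z.mem_EM_of_absorbs hε.le (by change 0 ≤ τ; linarith) h0 hm.monotone hC hD
      (fun t ht => habs (frakC g) hF t ht Z rfl rfl rfl rfl hC hD) hs hsd hsat hM hζ hk hE h₁ h₂
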